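/- arXiv:1109.2415 — 2 statements merged into one kernel-verified Lean document; each statement's English description precedes it below -/
import Mathlib

section
/- Assume g is μ-strongly convex with 0 < μ ≤ L and set γ = μ/L and α = √γ. Consider the accelerated inexact proximal-gradient method for strongly convex objectives: y_k = x_k + ((1 − √γ)/(1 + √γ))(x_k − x_{k-1}) with y_0 = x_0, and for each k ≥ 1, x_k is an ε_k-optimal solution of the proximal problem at y_{k-1} − (1/L)(g'(y_{k-1}) + e_k). Define v_k = x_{k-1} + (1/α)(x_k − x_{k-1}) with v_0 = x_0, and δ_k = f(x_k) − f(x*) + (μ/2)‖v_k − x*‖². Then for all k ≥ 1, δ_k ≤ (1 − √γ) δ_{k-1} + ε_k + √γ ( ‖e_k‖ + √(2Lε_k) ) ‖v_k − x*‖. -/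
open scoped RealInnerProductSpace
open Finset

noncomputable section

variable {E : Type*} [NormedAddCommGroup E] [InnerProductSpace ℝ E] [CompleteSpace E]

/-- The ε-subdifferential of an `EReal`-valued function `a` at `x`:
the set of `y` such that `a t ≥ a x + ⟪y, t - x⟫ - ε` for all `t`. -/
def epsSubdiff (a : E → EReal) (ε : ℝ) (x : E) : Set E :=
  {y | ∀ t : E, a x + ((⟪y, t - x⟫ : ℝ) : EReal) - ((ε : ℝ) : EReal) ≤ a t}

/-- The objective function of the proximal problem at `y`. -/
def proxObj (L : ℝ) (h : E → EReal) (y x : E) : EReal :=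
  ((L / 2 * ‖x - y‖ ^ 2 : ℝ) : EReal) + h x

/-- `x` is an `ε`-optimal solution of the proximal problem at `y`. -/
def IsEpsOptimal (L : ℝ) (h : E → EReal) (ε : ℝ) (y x : E) : Prop :=
  proxObj L h y x ≤ ((ε : ℝ) : EReal) + ⨅ z : E, proxObj L h y z

/-- Convexity for `EReal`-valued functions. -/
def ERealConvexOn (h : E → EReal) : Prop :=
  ∀ x y : E, ∀ a b : ℝ, 0 ≤ a → 0 ≤ b → a + b = 1 →
    h (a • x + b • y) ≤ ((a : ℝ) : EReal) * h x + ((b : ℝ) : EReal) * h y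

/-- The descent lemma: a function with `L`-Lipschitz gradient is bounded above by its quadratic
model. -/
theorem le_quadratic_of_lipschitz_gradient {L : ℝ} {g : E → ℝ} {g' : E → E}
    (hgrad : ∀ w, HasGradientAt g (g' w) w)
    (hlip : ∀ w w', ‖g' w - g' w'‖ ≤ L * ‖w - w'‖) (y x : E) :
    g x ≤ g y + ⟪g' y, x - y⟫ + L / 2 * ‖x - y‖ ^ 2 := by
  set d := x - y with hd
  let φ : ℝ → ℝ := fun t => g (y + t • d) - t * ⟪g' y, d⟫ - t ^ 2 * (L / 2 * ‖d‖ ^ 2)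
  have hφ : ∀ t, HasDerivAt φ
      (⟪g' (y + t • d), d⟫ - ⟪g' y, d⟫ - 2 * t * (L / 2 * ‖d‖ ^ 2)) t := by
    intro t
    have hline : HasDerivAt (fun t : ℝ => y + t • d) d t := by
      simpa using ((hasDerivAt_id t).smul_const d).const_add y
    have hg : HasDerivAt (fun t : ℝ => g (y + t • d)) ⟪g' (y + t • d), d⟫ t := by
      simpa [Function.comp_def] using
        (hgrad (y + t • d)).hasFDerivAt.comp_hasDerivAt t hline
    have hlin : HasDerivAt (fun t : ℝ => t * ⟪g' y, d⟫) ⟪g' y, d⟫ t := by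
      simpa using (hasDerivAt_id t).mul_const ⟪g' y, d⟫
    have hsq : HasDerivAt (fun t : ℝ => t ^ 2 * (L / 2 * ‖d‖ ^ 2))
        (2 * t * (L / 2 * ‖d‖ ^ 2)) t := by
      simpa using (hasDerivAt_pow 2 t).mul_const (L / 2 * ‖d‖ ^ 2)
    exact (hg.sub hlin).sub hsq
  have hanti : AntitoneOn φ (Set.Icc 0 1) := by
    refine antitoneOn_of_deriv_nonpos (convex_Icc 0 1)
      (fun t _ => (hφ t).continuousAt.continuousWithinAt)
      (fun t _ => (hφ t).differentiableAt.differentiableWithinAt) fun t ht => ?_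
    rw [interior_Icc] at ht
    have hinner : ⟪g' (y + t • d), d⟫ - ⟪g' y, d⟫ ≤ L * (t * ‖d‖) * ‖d‖ := by
      rw [← inner_sub_left]
      refine (real_inner_le_norm _ _).trans (mul_le_mul_of_nonneg_right ?_ (norm_nonneg d))
      simpa [norm_smul, abs_of_pos ht.1] using hlip (y + t • d) y
    rw [(hφ t).deriv]
    linarith
  have h01 := hanti (Set.left_mem_Icc.2 zero_le_one) (Set.right_mem_Icc.2 zero_le_one) zero_le_one
  have hxy : y + d = x := by simp [hd]
  simp only [φ, one_smul, zero_smul, add_zero, hxy] at h01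
  linarith

omit [InnerProductSpace ℝ E] [CompleteSpace E] in
/-- An `ε`-optimal solution of a proximal problem has a finite function value. -/
theorem IsEpsOptimal.exists_eq_coe {L ε : ℝ} {h : E → EReal} {y x w : E}
    (hx : IsEpsOptimal L h ε y x) (hw : h w ≠ ⊤) (hbot : ∀ w, h w ≠ ⊥) :
    ∃ b : ℝ, h x = b := by
  refine ⟨(h x).toReal, (EReal.coe_toReal (fun htop => ?_) (hbot x)).symm⟩
  have hle : proxObj L h y x ≤ (ε : EReal) + proxObj L h y w :=
    hx.trans (by gcongr; exact iInf_le _ w)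
  lift h w to ℝ using ⟨hw, hbot w⟩ with c hc
  rw [proxObj, proxObj, htop, ← hc, EReal.coe_add_top, ← EReal.coe_add, ← EReal.coe_add,
    top_le_iff] at hle
  exact EReal.coe_ne_top _ hle

omit [CompleteSpace E] in
/-- An `ε`-optimal solution `x` of the proximal problem at `y` satisfies the subgradient
inequality for `L • (y - x)` up to the error `ε + √(2Lε) ‖z - x‖`. -/
theorem IsEpsOptimal.le_add {L ε : ℝ} (hL : 0 < L) (hε : 0 ≤ ε) {h : E → EReal}
    (hconv : ERealConvexOn h) {y x z : E} {b c : ℝ}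
    (hx : IsEpsOptimal L h ε y x) (hb : h x = b) (hc : h z ≤ c) :
    b ≤ c + L * ⟪x - y, z - x⟫ + ε + Real.sqrt (2 * L * ε) * ‖z - x‖ := by
  have key : ∀ t : ℝ, 0 ≤ t → t ≤ 1 →
      t * b ≤ t * c + t * (L * ⟪x - y, z - x⟫) + ε + t ^ 2 * (L / 2 * ‖z - x‖ ^ 2) := by
    intro t ht0 ht1
    have hseg : h ((1 - t) • x + t • z) ≤ (((1 - t) * b + t * c : ℝ) : EReal) := by
      refine (hconv x z (1 - t) t (by linarith) ht0 (by ring)).trans ?_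
      rw [hb, EReal.coe_add, EReal.coe_mul, EReal.coe_mul]
      gcongr
    have hle : proxObj L h y x ≤ (ε : EReal) + proxObj L h y ((1 - t) • x + t • z) :=
      hx.trans (by gcongr; exact iInf_le _ _)
    have hle' : proxObj L h y x ≤ (ε : EReal) +
        (((L / 2 * ‖(1 - t) • x + t • z - y‖ ^ 2 : ℝ) : EReal) +
          (((1 - t) * b + t * c : ℝ) : EReal)) :=
      hle.trans (by unfold proxObj; gcongr)
    rw [proxObj, hb] at hle'
    have hreal : L / 2 * ‖x - y‖ ^ 2 + b ≤
        ε + (L / 2 * ‖(1 - t) • x + t • z - y‖ ^ 2 + ((1 - t) * b + t * c)) := by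
      exact_mod_cast hle'
    have hexp : ‖(1 - t) • x + t • z - y‖ ^ 2 =
        ‖x - y‖ ^ 2 + 2 * (t * ⟪x - y, z - x⟫) + t ^ 2 * ‖z - x‖ ^ 2 := by
      rw [show (1 - t) • x + t • z - y = (x - y) + t • (z - x) by module,
        norm_add_sq_real, real_inner_smul_right, norm_smul, mul_pow, Real.norm_eq_abs, sq_abs]
    rw [hexp] at hreal
    linarith
  set n := ‖z - x‖
  set s := Real.sqrt (2 * L * ε)
  have hn0 : 0 ≤ n := norm_nonneg _
  have hs0 : 0 ≤ s := Real.sqrt_nonneg _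
  have hs2 : s ^ 2 = 2 * L * ε := Real.sq_sqrt (by positivity)
  rcases le_or_gt (L * n) s with hsn | hsn
  · have h1 := key 1 zero_le_one le_rfl
    nlinarith [mul_le_mul_of_nonneg_right hsn hn0, mul_nonneg hs0 hn0]
  · have hLn : 0 < L * n := hs0.trans_lt hsn
    have hnpos : 0 < n := pos_of_mul_pos_right hLn hL.le
    rcases hs0.eq_or_lt with hs_zero | hspos
    · have hε0 : ε = 0 := by
        rw [← hs_zero] at hs2
        have : L * ε = 0 := by linarith
        exact (mul_eq_zero.1 this).resolve_left hL.ne'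
      rw [← hs_zero, hε0]
      refine le_of_forall_pos_le_add fun η hη => ?_
      have hq : 0 < L / 2 * n ^ 2 := by positivity
      obtain ⟨t, ht0, ht1, htη⟩ : ∃ t : ℝ, 0 < t ∧ t ≤ 1 ∧ t * (L / 2 * n ^ 2) ≤ η :=
        ⟨min 1 (η / (L / 2 * n ^ 2)), by positivity, min_le_left _ _,
          (le_div_iff₀ hq).1 (min_le_right _ _)⟩
      have ht := key t ht0.le ht1
      rw [hε0] at ht
      have : t * b ≤ t * (c + L * ⟪x - y, z - x⟫ + t * (L / 2 * n ^ 2)) := by linarith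
      have := le_of_mul_le_mul_left this ht0
      linarith
    · have ht0 : 0 < s / (L * n) := by positivity
      have ht := key (s / (L * n)) ht0.le ((div_le_one hLn).2 hsn.le)
      have hεt : ε = s / (L * n) * (s * n / 2) := by
        field_simp
        linarith
      have htt : (s / (L * n)) ^ 2 * (L / 2 * n ^ 2) = s / (L * n) * (s * n / 2) := by
        field_simp
      have : s / (L * n) * b ≤
          s / (L * n) * (c + L * ⟪x - y, z - x⟫ + s * n / 2 + s * n / 2) := by
        linarith
      have := le_of_mul_le_mul_left this ht0
      linarith

/-- One step of the accelerated inexact proximal-gradient method, in terms of real values: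
`p` is the previous iterate, `q` the new one, `y` the extrapolated point, and `u`, `v` are the
previous and the new auxiliary points. The real numbers `a`, `b`, `s` stand for the values of `h`
at `p`, `q`, `xs`. -/
theorem accelerated_step {L μ α : ℝ} (hL : 0 < L) (hα0 : 0 < α) (hα1 : α ≤ 1)
    (hμα : μ = L * α ^ 2) {g : E → ℝ} {g' : E → E}
    (hgrad : ∀ w, HasGradientAt g (g' w) w)
    (hlip : ∀ w w', ‖g' w - g' w'‖ ≤ L * ‖w - w'‖)
    (hsc : ∀ w w', g w + ⟪g' w, w' - w⟫ + μ / 2 * ‖w' - w‖ ^ 2 ≤ g w')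
    {h : E → EReal} (hconv : ERealConvexOn h) {ε a b s : ℝ} (hε : 0 ≤ ε)
    {p q y u v e xs : E}
    (hq : IsEpsOptimal L h ε (y - (1 / L) • (g' y + e)) q) (hb : h q = b)
    (hz : h ((1 - α) • p + α • xs) ≤ (((1 - α) * a + α * s : ℝ) : EReal))
    (hp : p = (1 + α) • y - α • u) (hv : q = (1 - α) • p + α • v) :
    g q + b - (g xs + s) + μ / 2 * ‖v - xs‖ ^ 2 ≤
      (1 - α) * (g p + a - (g xs + s) + μ / 2 * ‖u - xs‖ ^ 2) +
        (ε + α * (‖e‖ + Real.sqrt (2 * L * ε)) * ‖v - xs‖) := by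
  set z := (1 - α) • p + α • xs with hzdef
  have hprox := hq.le_add hL hε hconv hb hz
  have hqz : z - q = α • (xs - v) := by rw [hzdef, hv]; module
  have hnorm : ‖z - q‖ = α * ‖v - xs‖ := by
    rw [hqz, norm_smul, Real.norm_eq_abs, abs_of_pos hα0, norm_sub_rev]
  have hinner : L * ⟪q - (y - (1 / L) • (g' y + e)), z - q⟫ =
      L * ⟪q - y, z - q⟫ + ⟪g' y, z - q⟫ + ⟪e, z - q⟫ := by
    rw [show q - (y - (1 / L) • (g' y + e)) = (q - y) + (1 / L) • (g' y + e) by module,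
      inner_add_left, real_inner_smul_left, inner_add_left]
    field_simp
    ring
  have he : ⟪e, z - q⟫ ≤ ‖e‖ * (α * ‖v - xs‖) := hnorm ▸ real_inner_le_norm e (z - q)
  have hdesc := le_quadratic_of_lipschitz_gradient hgrad hlip y q
  have hgp := mul_le_mul_of_nonneg_left (hsc y p) (sub_nonneg.2 hα1)
  have hgs := mul_le_mul_of_nonneg_left (hsc y xs) hα0.le
  have hlin : ⟪g' y, q - y⟫ + ⟪g' y, z - q⟫ =
      (1 - α) * ⟪g' y, p - y⟫ + α * ⟪g' y, xs - y⟫ := by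
    rw [← inner_add_right, ← real_inner_smul_right, ← real_inner_smul_right, ← inner_add_right,
      hzdef]
    congr 1
    module
  have hsq : ‖z - y‖ ^ 2 = ‖q - y‖ ^ 2 + 2 * ⟪q - y, z - q⟫ + α ^ 2 * ‖v - xs‖ ^ 2 := by
    rw [← mul_pow, ← hnorm, ← norm_add_sq_real]
    congr 2
    abel
  have hzy : ‖z - y‖ ^ 2 ≤ α ^ 2 * (α * ‖xs - y‖ ^ 2 + (1 - α) * ‖u - xs‖ ^ 2) := by
    have hzy' : z - y = α • (α • (xs - y) + (1 - α) • (xs - u)) := by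
      rw [hzdef, hp]
      module
    have hcvx : ‖α • (xs - y) + (1 - α) • (xs - u)‖ ^ 2 ≤
        α * ‖xs - y‖ ^ 2 + (1 - α) * ‖u - xs‖ ^ 2 := by
      have := (convexOn_univ_norm (E := E)).pow (fun w _ => norm_nonneg w) 2
      simpa [norm_sub_rev u xs] using
        this.2 (Set.mem_univ (xs - y)) (Set.mem_univ (xs - u)) hα0.le (sub_nonneg.2 hα1)
          (by ring)
    rw [hzy', norm_smul, mul_pow, Real.norm_eq_abs, sq_abs]
    gcongr
  have hzy_scaled := mul_le_mul_of_nonneg_left hzy (half_pos hL).le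
  have hdrop : 0 ≤ (1 - α) * (μ / 2 * ‖p - y‖ ^ 2) := by
    have := sub_nonneg.2 hα1
    rw [hμα]
    positivity
  rw [hsq] at hzy_scaled
  rw [hinner, hnorm] at hprox
  rw [hμα] at *
  linarith

theorem stmt_16
    (L μ : ℝ) (hμ : 0 < μ) (hμL : μ ≤ L)
    (g : E → ℝ) (g' : E → E)
    (hgrad : ∀ w, HasGradientAt g (g' w) w)
    (hlip : ∀ w w', ‖g' w - g' w'‖ ≤ L * ‖w - w'‖)
    (hsc : ∀ w w', g w + ⟪g' w, w' - w⟫ + μ / 2 * ‖w' - w‖ ^ 2 ≤ g w')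
    (h : E → EReal)
    (hhconv : ERealConvexOn h)
    (hhlsc : LowerSemicontinuous h)
    (hhproper : ∃ w, h w ≠ ⊤) (hhnbot : ∀ w, h w ≠ ⊥)
    (f : E → EReal) (hf : ∀ w, f w = ((g w : ℝ) : EReal) + h w)
    (xstar : E) (hmin : ∀ w, f xstar ≤ f w)
    (γ : ℝ) (hγ : γ = μ / L)
    (x y e : ℕ → E) (ε : ℕ → ℝ) (hεnn : ∀ k, 0 ≤ ε k)
    (hy0 : y 0 = x 0)
    (hy : ∀ k, 1 ≤ k → y k = x k +
      ((1 - Real.sqrt γ) / (1 + Real.sqrt γ)) • (x k - x (k - 1)))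
    (hstep : ∀ k, 1 ≤ k →
      IsEpsOptimal L h (ε k) (y (k - 1) - (1 / L) • (g' (y (k - 1)) + e k)) (x k))
    (v : ℕ → E) (hv : ∀ k, v k = x (k - 1) + (1 / Real.sqrt γ) • (x k - x (k - 1)))
    (δ : ℕ → EReal)
    (hδ : ∀ k, δ k = f (x k) - f xstar + ((μ / 2 * ‖v k - xstar‖ ^ 2 : ℝ) : EReal)) :
    ∀ k, 1 ≤ k →
      δ k ≤ ((1 - Real.sqrt γ : ℝ) : EReal) * δ (k - 1) +
        ((ε k + Real.sqrt γ * (‖e k‖ + Real.sqrt (2 * L * ε k)) *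
          ‖v k - xstar‖ : ℝ) : EReal) := by
  have hL : 0 < L := hμ.trans_le hμL
  have hγ0 : 0 < γ := hγ ▸ div_pos hμ hL
  have hγ1 : γ ≤ 1 := hγ ▸ (div_le_one hL).2 hμL
  set α := Real.sqrt γ with hα
  have hα0 : 0 < α := Real.sqrt_pos.2 hγ0
  have hα1 : α ≤ 1 := Real.sqrt_le_one.2 hγ1
  have hμα : μ = L * α ^ 2 := by
    rw [hα, Real.sq_sqrt hγ0.le, hγ]
    field_simp
  obtain ⟨w, hw⟩ := hhproper
  have hs : ∃ s : ℝ, h xstar = s := by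
    refine ⟨(h xstar).toReal, (EReal.coe_toReal (fun htop => ?_) (hhnbot xstar)).symm⟩
    have hle := hmin w
    rw [hf, hf, htop, EReal.coe_add_top, top_le_iff] at hle
    exact EReal.add_ne_top (EReal.coe_ne_top _) hw hle
  obtain ⟨s, hs⟩ := hs
  intro k hk
  obtain ⟨n, rfl⟩ : ∃ n, k = n + 1 := ⟨k - 1, by omega⟩
  have hq := hstep (n + 1) hk
  have hvk := hv (n + 1)
  simp only [Nat.add_sub_cancel] at hq hvk ⊢
  obtain ⟨b, hb⟩ := hq.exists_eq_coe hw hhnbot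
  have hp : x n = (1 + α) • y n - α • v n := by
    rcases Nat.eq_zero_or_pos n with rfl | hn
    · rw [hy0, hv 0]
      simp only [Nat.zero_sub, sub_self, smul_zero, add_zero]
      module
    · rw [hy n hn, hv n]
      match_scalars <;> field_simp <;> ring
  have hvq : x (n + 1) = (1 - α) • x n + α • v (n + 1) := by
    rw [hvk]
    match_scalars <;> field_simp
    ring
  have hfin : ∀ a : ℝ,
      h ((1 - α) • x n + α • xstar) ≤ (((1 - α) * a + α * s : ℝ) : EReal) →
      δ (n + 1) ≤ (((1 - α) * (g (x n) + a - (g xstar + s) + μ / 2 * ‖v n - xstar‖ ^ 2) +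
        (ε (n + 1) + α * (‖e (n + 1)‖ + Real.sqrt (2 * L * ε (n + 1))) *
          ‖v (n + 1) - xstar‖) : ℝ) : EReal) := by
    intro a hz
    have hstep_real := accelerated_step hL hα0 hα1 hμα hgrad hlip hsc hhconv (hεnn (n + 1))
      hq hb hz hp hvq
    rw [hδ, hf, hf, hb, hs]
    exact_mod_cast hstep_real
  by_cases htop : h (x n) = ⊤
  · rcases hα1.eq_or_lt with hα_one | hα_lt
    · have hle := hfin 0 (by simp [hα_one, hs])
      simpa [hα_one] using hle
    · have hδtop : δ n = ⊤ := by
        rw [hδ, hf, hf, htop, hs, EReal.coe_add_top, ← EReal.coe_add, EReal.top_sub_coe,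
          EReal.top_add_coe]
      rw [hδtop, EReal.coe_mul_top_of_pos (sub_pos.2 hα_lt), EReal.top_add_coe]
      exact le_top
  · lift h (x n) to ℝ using ⟨htop, hhnbot _⟩ with a ha
    refine (hfin a ?_).trans_eq ?_
    · have hle := hhconv (x n) xstar (1 - α) α (sub_nonneg.2 hα1) hα0.le (by ring)
      rw [← ha, hs] at hle
      exact_mod_cast hle
    · rw [hδ n, hf, hf, ← ha, hs]
      norm_cast
end
end

section
/- Consider the basic inexact proximal-gradient method (y_k = x_k): for each k ≥ 1, x_k is an ε_k-optimal solution of the proximal problem at x_{k-1} − (1/L)(g'(x_{k-1}) + e_k). Define A_k = Σ_{i=1}^k ( ‖e_i‖/L + √(2ε_i/L) ) and B_k = Σ_{i=1}^k ε_i/L. Then for all k ≥ 1, Σ_{i=1}^k [f(x_i) − f(x*)] + (L/2)‖x_k − x*‖² ≤ (L/2)‖x_0 − x*‖² + L B_k + Σ_{i=1}^k ( ‖e_i‖ + √(2Lε_i) ) ‖x_i − x*‖. -/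
open scoped RealInnerProductSpace
open Finset

noncomputable section

variable {E : Type*} [NormedAddCommGroup E] [InnerProductSpace ℝ E] [CompleteSpace E]

/-- A differentiable function composed with the affine parametrisation of a line. -/
theorem HasGradientAt.hasDerivAt_comp_line {g : E → ℝ} {g' : E → E} (w d : E) (t : ℝ)
    (hgrad : HasGradientAt g (g' (w + t • d)) (w + t • d)) :
    HasDerivAt (fun s : ℝ => g (w + s • d)) ⟪g' (w + t • d), d⟫ t := by
  have hline : HasDerivAt (fun s : ℝ => w + s • d) d t := by
    simpa using ((hasDerivAt_id t).smul_const d).const_add w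
  simpa [Function.comp_def] using hgrad.hasFDerivAt.comp_hasDerivAt t hline

/-- The first-order lower bound for a convex function. -/
theorem ConvexOn.add_inner_gradient_le {g : E → ℝ} {g' : E → E}
    (hgconv : ConvexOn ℝ Set.univ g) (hgrad : ∀ w, HasGradientAt g (g' w) w) (w z : E) :
    g w + ⟪g' w, z - w⟫ ≤ g z := by
  have hconv : ConvexOn ℝ Set.univ (fun s : ℝ => g (w + s • (z - w))) := by
    refine ⟨convex_univ, fun a _ b _ p q hp hq hpq => ?_⟩
    convert hgconv.2 (Set.mem_univ (w + a • (z - w))) (Set.mem_univ (w + b • (z - w)))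
      hp hq hpq using 2
    obtain rfl : q = 1 - p := by linarith
    module
  have hslope := hconv.le_slope_of_hasDerivAt (Set.mem_univ 0) (Set.mem_univ 1) zero_lt_one
    ((hgrad _).hasDerivAt_comp_line w (z - w) 0)
  simp only [slope_def_field, zero_smul, add_zero, one_smul, add_sub_cancel, sub_zero,
    div_one] at hslope
  linarith

/-- The descent lemma: the quadratic upper bound for a function with Lipschitz gradient. -/
theorem le_add_inner_gradient_add_sq {g : E → ℝ} {g' : E → E} {L : ℝ}
    (hgrad : ∀ w, HasGradientAt g (g' w) w)
    (hlip : ∀ w w', ‖g' w - g' w'‖ ≤ L * ‖w - w'‖) (w z : E) :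
    g z ≤ g w + ⟪g' w, z - w⟫ + L / 2 * ‖z - w‖ ^ 2 := by
  set d := z - w with hd
  have hderiv : ∀ t : ℝ, HasDerivAt
      (fun s : ℝ => g (w + s • d) - s * ⟪g' w, d⟫ - L / 2 * ‖d‖ ^ 2 * s ^ 2)
      (⟪g' (w + t • d), d⟫ - ⟪g' w, d⟫ - L * ‖d‖ ^ 2 * t) t := by
    intro t
    refine ((((hgrad _).hasDerivAt_comp_line w d t).sub
      ((hasDerivAt_id t).mul_const ⟪g' w, d⟫)).sub
      ((hasDerivAt_pow 2 t).const_mul (L / 2 * ‖d‖ ^ 2))).congr_deriv ?_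
    push_cast
    ring
  have hanti := antitoneOn_of_hasDerivWithinAt_nonpos (convex_Icc (0 : ℝ) 1)
    (fun t _ => (hderiv t).continuousAt.continuousWithinAt)
    (fun t _ => (hderiv t).hasDerivWithinAt) (fun t ht => by
      rw [interior_Icc] at ht
      have hcs := real_inner_le_norm (g' (w + t • d) - g' w) d
      have hl := hlip (w + t • d) w
      rw [add_sub_cancel_left, norm_smul, Real.norm_of_nonneg ht.1.le] at hl
      rw [inner_sub_left] at hcs
      nlinarith [mul_le_mul_of_nonneg_right hl (norm_nonneg d)])
  have := hanti (Set.left_mem_Icc.2 zero_le_one) (Set.right_mem_Icc.2 zero_le_one) zero_le_one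
  simp only [one_smul, zero_smul, add_zero, hd, add_sub_cancel] at this
  linarith

/-- Optimising the bound `ε / t + t * L * N ^ 2 / 2` over the step size `t ∈ (0, 1]`. -/
theorem le_add_sqrt_mul_of_forall_step {L D N ε : ℝ} (hL : 0 < L) (hN : 0 ≤ N) (hε : 0 ≤ ε)
    (hD : ∀ t, 0 < t → t ≤ 1 → t * D ≤ ε + t ^ 2 * (L / 2 * N ^ 2)) :
    D ≤ ε + √(2 * L * ε) * N := by
  obtain ⟨s, hs, rfl⟩ : ∃ s, 0 ≤ s ∧ ε = L / 2 * s ^ 2 := by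
    refine ⟨√(2 * ε / L), Real.sqrt_nonneg _, ?_⟩
    rw [Real.sq_sqrt (by positivity)]
    field_simp
  have hsqrt : √(2 * L * (L / 2 * s ^ 2)) = L * s := by
    rw [show 2 * L * (L / 2 * s ^ 2) = (L * s) ^ 2 by ring, Real.sqrt_sq (by positivity)]
  rw [hsqrt]
  rcases le_or_gt N s with hNs | hsN
  · have h1 := hD 1 one_pos le_rfl
    nlinarith [mul_le_mul_of_nonneg_left (mul_le_mul_of_nonneg_right hNs hN) hL.le,
      mul_nonneg (mul_nonneg hL.le hs) hN]
  have hNpos : 0 < N := hs.trans_lt hsN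
  rcases hs.eq_or_lt with rfl | hspos
  · simp only [ne_eq, OfNat.ofNat_ne_zero, not_false_eq_true, zero_pow, mul_zero, zero_mul,
      add_zero, zero_add] at hD ⊢
    by_contra! hDpos
    set C := L / 2 * N ^ 2
    have hC : 0 < C := by positivity
    have ht : 0 < D / (D + C) := by positivity
    have h1 := hD _ ht ((div_le_one (by positivity)).2 (by linarith))
    have h2 : D ≤ D / (D + C) * C := by
      refine le_of_mul_le_mul_left ?_ ht
      linarith
    have h3 : D / (D + C) * C < D := by
      rw [div_mul_eq_mul_div, div_lt_iff₀ (by positivity)]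
      nlinarith
    linarith
  · have h1 := hD (s / N) (by positivity) ((div_le_one hNpos).2 hsN.le)
    have h2 : s * D ≤ s * (L * s * N) := by
      have h3 := mul_le_mul_of_nonneg_left h1 hNpos.le
      have h4 : N * (s / N * D) = s * D := by field_simp
      have h5 : N * (L / 2 * s ^ 2 + (s / N) ^ 2 * (L / 2 * N ^ 2)) = s * (L * s * N) := by
        field_simp
        ring
      linarith
    have h6 := le_of_mul_le_mul_left h2 hspos
    nlinarith [mul_nonneg hL.le (sq_nonneg s)]

/-- An `ε`-optimal solution lies in the effective domain. -/
theorem IsEpsOptimal.ne_top {F : Type*} [NormedAddCommGroup F] {L ε : ℝ} {h : F → EReal}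
    {y x w : F}
    (hopt : IsEpsOptimal L h ε y x) (hw : h w ≠ ⊤) : h x ≠ ⊤ := by
  intro hx
  have hle : proxObj L h y x ≤ (ε : EReal) + proxObj L h y w :=
    hopt.trans (add_le_add le_rfl (iInf_le _ w))
  rw [proxObj, hx, EReal.coe_add_top, top_le_iff, proxObj] at hle
  exact EReal.add_ne_top (EReal.coe_ne_top _) (EReal.add_ne_top (EReal.coe_ne_top _) hw) hle

/-- An `ε`-optimal solution of the proximal problem satisfies an approximate subgradient
inequality. -/
theorem IsEpsOptimal.subgradient_inequality {F : Type*} [NormedAddCommGroup F]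
    [InnerProductSpace ℝ F] {L ε : ℝ} (hL : 0 < L) (hε : 0 ≤ ε) {h : F → EReal}
    (hhconv : ERealConvexOn h) {y x z : F} (hopt : IsEpsOptimal L h ε y x) {a b : ℝ}
    (ha : h x = a) (hb : h z = b) :
    a + L * ⟪y - x, z - x⟫ ≤ b + ε + √(2 * L * ε) * ‖x - z‖ := by
  suffices a + L * ⟪y - x, z - x⟫ - b ≤ ε + √(2 * L * ε) * ‖x - z‖ by linarith
  refine le_add_sqrt_mul_of_forall_step hL (norm_nonneg _) hε fun t ht ht1 => ?_
  have hle : proxObj L h y x ≤ (ε : EReal) + proxObj L h y ((1 - t) • x + t • z) :=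
    hopt.trans (add_le_add le_rfl (iInf_le _ _))
  have hconv := hhconv x z (1 - t) t (by linarith) ht.le (by ring)
  have hle' := hle.trans (add_le_add le_rfl (add_le_add le_rfl hconv))
  rw [proxObj, ha, hb] at hle'
  norm_cast at hle'
  have hdir : (1 - t) • x + t • z - y = (x - y) - t • (x - z) := by module
  rw [hdir, norm_sub_sq_real (x - y), real_inner_smul_right, norm_smul, mul_pow,
    Real.norm_of_nonneg ht.le] at hle'
  have hinner : ⟪y - x, z - x⟫ = ⟪x - y, x - z⟫ := by
    rw [← neg_sub x y, ← neg_sub x z, inner_neg_neg]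
  rw [hinner]
  linarith

/-- One step of the inexact proximal-gradient method. -/
theorem inexact_proximal_gradient_step {L ε : ℝ} (hL : 0 < L) (hε : 0 ≤ ε)
    {g : E → ℝ} {g' : E → E} (hgconv : ConvexOn ℝ Set.univ g)
    (hgrad : ∀ w, HasGradientAt g (g' w) w)
    (hlip : ∀ w w', ‖g' w - g' w'‖ ≤ L * ‖w - w'‖) {h : E → EReal} (hhconv : ERealConvexOn h)
    {w x z e : E} (hopt : IsEpsOptimal L h ε (w - (1 / L) • (g' w + e)) x) {a b : ℝ}
    (ha : h x = a) (hb : h z = b) :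
    (g x + a) - (g z + b) + L / 2 * ‖x - z‖ ^ 2 ≤
      L / 2 * ‖w - z‖ ^ 2 + ε + (‖e‖ + √(2 * L * ε)) * ‖x - z‖ := by
  have hsub := hopt.subgradient_inequality hL hε hhconv ha hb
  have hcvx := hgconv.add_inner_gradient_le hgrad w z
  have hdesc := le_add_inner_gradient_add_sq hgrad hlip w x
  have hcs := real_inner_le_norm e (z - x)
  rw [norm_sub_rev z x] at hcs
  have hexp : L * ⟪w - (1 / L) • (g' w + e) - x, z - x⟫ =
      L * ⟪w - x, z - x⟫ - ⟪g' w, z - x⟫ - ⟪e, z - x⟫ := by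
    rw [sub_right_comm, inner_sub_left, real_inner_smul_left, inner_add_left]
    field_simp
    ring
  have hsplit : ⟪g' w, z - w⟫ = ⟪g' w, z - x⟫ + ⟪g' w, x - w⟫ := by
    rw [← inner_add_right, sub_add_sub_cancel]
  have hsq : ‖w - z‖ ^ 2 = ‖x - w‖ ^ 2 - 2 * ⟪w - x, z - x⟫ + ‖x - z‖ ^ 2 := by
    rw [← sub_sub_sub_cancel_right w z x, norm_sub_sq_real, norm_sub_rev w x, norm_sub_rev z x]
  rw [hexp] at hsub
  rw [hsq]
  linarith

theorem stmt_19
    (L : ℝ) (hL : 0 < L)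
    (g : E → ℝ) (g' : E → E)
    (hgconv : ConvexOn ℝ Set.univ g)
    (hgrad : ∀ w, HasGradientAt g (g' w) w)
    (hlip : ∀ w w', ‖g' w - g' w'‖ ≤ L * ‖w - w'‖)
    (h : E → EReal)
    (hhconv : ERealConvexOn h)
    (hhlsc : LowerSemicontinuous h)
    (hhproper : ∃ w, h w ≠ ⊤) (hhnbot : ∀ w, h w ≠ ⊥)
    (f : E → EReal) (hf : ∀ w, f w = ((g w : ℝ) : EReal) + h w)
    (xstar : E) (hmin : ∀ w, f xstar ≤ f w)
    (x e : ℕ → E) (ε : ℕ → ℝ) (hεnn : ∀ k, 0 ≤ ε k)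
    (hstep : ∀ k, 1 ≤ k →
      IsEpsOptimal L h (ε k) (x (k - 1) - (1 / L) • (g' (x (k - 1)) + e k)) (x k))
    (A B : ℕ → ℝ)
    (hA : ∀ k, A k = ∑ i ∈ Icc 1 k, (‖e i‖ / L + Real.sqrt (2 * ε i / L)))
    (hB : ∀ k, B k = ∑ i ∈ Icc 1 k, ε i / L)
    :
    ∀ k, 1 ≤ k →
      (∑ i ∈ Icc 1 k, (f (x i) - f xstar)) + ((L / 2 * ‖x k - xstar‖ ^ 2 : ℝ) : EReal) ≤
        ((L / 2 * ‖x 0 - xstar‖ ^ 2 + L * B k +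
          ∑ i ∈ Icc 1 k, (‖e i‖ + Real.sqrt (2 * L * ε i)) * ‖x i - xstar‖ : ℝ) : EReal) := by
  obtain ⟨w₀, hw₀⟩ := hhproper
  have hstar_top : h xstar ≠ ⊤ := by
    intro htop
    have hle := hmin w₀
    rw [hf, hf, htop, EReal.coe_add_top, top_le_iff] at hle
    exact EReal.add_ne_top (EReal.coe_ne_top _) hw₀ hle
  set b := (h xstar).toReal
  have hb : h xstar = b := (EReal.coe_toReal hstar_top (hhnbot _)).symm
  set a : ℕ → ℝ := fun i => (h (x i)).toReal
  have ha : ∀ i, 1 ≤ i → h (x i) = a i := fun i hi =>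
    (EReal.coe_toReal ((hstep i hi).ne_top hw₀) (hhnbot _)).symm
  have hreal : ∀ k, (∑ i ∈ Icc 1 k, ((g (x i) + a i) - (g xstar + b))) +
      L / 2 * ‖x k - xstar‖ ^ 2 ≤ L / 2 * ‖x 0 - xstar‖ ^ 2 + ∑ i ∈ Icc 1 k, ε i +
        ∑ i ∈ Icc 1 k, (‖e i‖ + √(2 * L * ε i)) * ‖x i - xstar‖ := by
    intro k
    induction k with
    | zero => simp
    | succ k ih =>
      have hk : 1 ≤ k + 1 := Nat.le_add_left 1 k
      have hone := inexact_proximal_gradient_step hL (hεnn (k + 1)) hgconv hgrad hlip hhconv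
        (hstep (k + 1) hk) (ha (k + 1) hk) hb
      rw [Nat.add_sub_cancel] at hone
      simp only [sum_Icc_succ_top hk]
      linarith
  have hsum : ∀ k, ∑ i ∈ Icc 1 k, (f (x i) - f xstar) =
      ((∑ i ∈ Icc 1 k, ((g (x i) + a i) - (g xstar + b)) : ℝ) : EReal) := by
    intro k
    induction k with
    | zero => simp
    | succ k ih =>
      have hk : 1 ≤ k + 1 := Nat.le_add_left 1 k
      rw [sum_Icc_succ_top hk, sum_Icc_succ_top hk, ih, hf, hf, ha _ hk, hb]
      norm_cast
  intro k _
  have hLB : L * B k = ∑ i ∈ Icc 1 k, ε i := by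
    rw [hB, mul_sum]
    exact sum_congr rfl fun i _ => mul_div_cancel₀ _ hL.ne'
  rw [hsum, hLB]
  exact_mod_cast hreal k
end
end
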